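/- For every n ∈ (0,1] and every t ∈ (0,1), the function t ↦ φ(n,t) = n^{−1} log E[Z_t^n] is differentiable and (d/dt) φ(n,t) = (1/2) ⟨ ω_t(i ↦ S_{ii} − S̃_{ii}) ⟩_{n,t} + ((n−1)/2) ⟨ Ω_t(S − S̃) ⟩_{n,t}. -/

import Mathlib

open MeasureTheory ProbabilityTheory Real Filter Topology

noncomputable section

/-- Law of `M` i.i.d. standard Gaussians. -/
def gMu (M : ℕ) : Measure (Fin M → ℝ) := Measure.pi fun _ => gaussianReal 0 1

/-- Joint law of two independent families of i.i.d. standard Gaussians. -/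
def gMu2 (M M' : ℕ) : Measure ((Fin M → ℝ) × (Fin M' → ℝ)) := (gMu M).prod (gMu M')

/-- The centered Gaussian family `U_i = Σ_k A_{ik} g_k`. -/
def gU {N M : ℕ} (A : Matrix (Fin N) (Fin M) ℝ) (i : Fin N) (g : Fin M → ℝ) : ℝ :=
  ∑ k, A i k * g k

/-- Covariance matrix `S = A Aᵀ`, i.e. `S_{ij} = E[U_i U_j]`. -/
def gS {N M : ℕ} (A : Matrix (Fin N) (Fin M) ℝ) (i j : Fin N) : ℝ :=
  ∑ k, A i k * A j k

/-- Interpolating partition function `Z_t = Σ_i w_i exp(√t U_i + √(1-t) Ũ_i)`. -/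
def gZ2 {N M M' : ℕ} (w : Fin N → ℝ) (A : Matrix (Fin N) (Fin M) ℝ)
    (A' : Matrix (Fin N) (Fin M') ℝ) (t : ℝ) (g : (Fin M → ℝ) × (Fin M' → ℝ)) : ℝ :=
  ∑ i, w i * Real.exp (Real.sqrt t * gU A i g.1 + Real.sqrt (1 - t) * gU A' i g.2)

/-- Gibbs weight `p_i(t)`. -/
def gP2 {N M M' : ℕ} (w : Fin N → ℝ) (A : Matrix (Fin N) (Fin M) ℝ)
    (A' : Matrix (Fin N) (Fin M') ℝ) (t : ℝ) (g : (Fin M → ℝ) × (Fin M' → ℝ))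
    (i : Fin N) : ℝ :=
  w i * Real.exp (Real.sqrt t * gU A i g.1 + Real.sqrt (1 - t) * gU A' i g.2) / gZ2 w A A' t g

/-- Deformed quenched average `⟨X⟩_{n,t} = E[Z_t^n X]/E[Z_t^n]`. -/
def gAvg2 {N M M' : ℕ} (w : Fin N → ℝ) (A : Matrix (Fin N) (Fin M) ℝ)
    (A' : Matrix (Fin N) (Fin M') ℝ) (n t : ℝ) (X : (Fin M → ℝ) × (Fin M' → ℝ) → ℝ) : ℝ :=
  (∫ g, gZ2 w A A' t g ^ n * X g ∂ gMu2 M M') / (∫ g, gZ2 w A A' t g ^ n ∂ gMu2 M M')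

/-- `φ(n,t) = n⁻¹ log E[Z_t^n]`. -/
def gPhi2 {N M M' : ℕ} (w : Fin N → ℝ) (A : Matrix (Fin N) (Fin M) ℝ)
    (A' : Matrix (Fin N) (Fin M') ℝ) (n t : ℝ) : ℝ :=
  n⁻¹ * Real.log (∫ g, gZ2 w A A' t g ^ n ∂ gMu2 M M')

lemma integral_sum_const_mul_sub {α ι : Type*} [MeasurableSpace α] [Fintype ι] {μ : Measure α}
    {f h : ι → α → ℝ} (hf : ∀ i, Integrable (f i) μ) (hh : ∀ i, Integrable (h i) μ) {a b : ℝ} :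
    ∫ x, ∑ i, (a * f i x - b * h i x) ∂μ = ∑ i, (a * ∫ x, f i x ∂μ - b * ∫ x, h i x ∂μ) := by
  refine (integral_finsetSum _ fun i _ => ((hf i).const_mul a).sub ((hh i).const_mul b)).trans ?_
  refine Finset.sum_congr rfl fun i _ => ?_
  rw [← integral_const_mul, ← integral_const_mul]
  exact integral_sub ((hf i).const_mul a) ((hh i).const_mul b)

lemma hasDerivAt_gaussianPDFReal_zero_one (x : ℝ) :
    HasDerivAt (gaussianPDFReal 0 1) (-(x * gaussianPDFReal 0 1 x)) x := by
  unfold gaussianPDFReal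
  have h : HasDerivAt (fun x : ℝ => -(x - 0) ^ 2 / (2 * ((1 : NNReal) : ℝ))) (-x) x := by
    have := ((((hasDerivAt_id x).sub_const 0).pow 2).neg).div_const (2 * ((1 : NNReal) : ℝ))
    refine this.congr_deriv ?_
    simp
    ring
  refine (h.exp.const_mul _).congr_deriv ?_
  ring

lemma integrable_gaussianReal_zero_one_iff {f : ℝ → ℝ} :
    Integrable f (gaussianReal 0 1) ↔ Integrable (fun x => gaussianPDFReal 0 1 x * f x) := by
  rw [gaussianReal_of_var_ne_zero _ one_ne_zero,
    integrable_withDensity_iff_integrable_smul' (measurable_gaussianPDF 0 1)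
      (ae_of_all _ fun _ => gaussianPDF_lt_top)]
  simp [toReal_gaussianPDF]

/-- Gaussian integration by parts on the line. -/
lemma integral_id_mul_gaussianReal {f f' : ℝ → ℝ} (hd : ∀ x, HasDerivAt f (f' x) x)
    (hf : Integrable f (gaussianReal 0 1)) (hf' : Integrable f' (gaussianReal 0 1))
    (hx : Integrable (fun x => x * f x) (gaussianReal 0 1)) :
    ∫ x, x * f x ∂(gaussianReal 0 1) = ∫ x, f' x ∂(gaussianReal 0 1) := by
  rw [integrable_gaussianReal_zero_one_iff] at hf hf' hx
  rw [integral_gaussianReal_eq_integral_smul one_ne_zero,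
    integral_gaussianReal_eq_integral_smul one_ne_zero]
  simp only [smul_eq_mul]
  have h := integral_eq_zero_of_hasDerivAt_of_integrable
    (f := fun x => gaussianPDFReal 0 1 x * f x)
    (f' := fun x => gaussianPDFReal 0 1 x * f' x - gaussianPDFReal 0 1 x * (x * f x))
    (fun x => ((hasDerivAt_gaussianPDFReal_zero_one x).mul (hd x)).congr_deriv (by ring))
    (hf'.sub hx) hf
  rw [integral_sub hf' hx] at h
  linarith

instance isProbabilityMeasure_gMu (M : ℕ) : IsProbabilityMeasure (gMu M) := by
  unfold gMu; infer_instance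

instance isProbabilityMeasure_gMu2 (M M' : ℕ) : IsProbabilityMeasure (gMu2 M M') := by
  unfold gMu2; infer_instance

/-- Gaussian integration by parts in one coordinate. -/
lemma integral_coord_mul_gMu {M : ℕ} (k : Fin M) {f f' : (Fin M → ℝ) → ℝ}
    (hd : ∀ g, HasDerivAt (fun a => f (Function.update g k a)) (f' g) (g k))
    (hf : Integrable f (gMu M)) (hf' : Integrable f' (gMu M))
    (hx : Integrable (fun g => g k * f g) (gMu M)) :
    ∫ g, g k * f g ∂(gMu M) = ∫ g, f' g ∂(gMu M) := by
  obtain _ | M := M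
  · exact k.elim0
  have hmp := (measurePreserving_piFinSuccAbove
    (fun _ : Fin (M + 1) => gaussianReal 0 1) k).symm
  have hint {h : (Fin (M + 1) → ℝ) → ℝ} (hh : Integrable h (gMu (M + 1))) :
      Integrable (fun p : ℝ × (Fin M → ℝ) => h (k.insertNth p.1 p.2))
        ((gaussianReal 0 1).prod (gMu M)) :=
    (hmp.integrable_comp_emb (MeasurableEquiv.measurableEmbedding _)).2 hh
  have heq (h : (Fin (M + 1) → ℝ) → ℝ) : ∫ g, h g ∂(gMu (M + 1)) =
      ∫ p : ℝ × (Fin M → ℝ), h (k.insertNth p.1 p.2) ∂((gaussianReal 0 1).prod (gMu M)) :=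
    (hmp.integral_comp (MeasurableEquiv.measurableEmbedding _) h).symm
  rw [heq, heq, integral_prod_symm _ (hint hx), integral_prod_symm _ (hint hf')]
  refine integral_congr_ae ?_
  filter_upwards [(hint hx).prod_left_ae, (hint hf').prod_left_ae, (hint hf).prod_left_ae]
    with y h1 h2 h3
  simp only [Fin.insertNth_apply_same] at h1 ⊢
  refine integral_id_mul_gaussianReal (fun a => ?_) h3 h2 h1
  simpa [Fin.update_insertNth] using hd (k.insertNth (α := fun _ => ℝ) a y)

lemma integral_fst_coord_mul_gMu2 {M M' : ℕ} (k : Fin M)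
    {f f' : (Fin M → ℝ) × (Fin M' → ℝ) → ℝ}
    (hd : ∀ g, HasDerivAt (fun a => f (Function.update g.1 k a, g.2)) (f' g) (g.1 k))
    (hf : Integrable f (gMu2 M M')) (hf' : Integrable f' (gMu2 M M'))
    (hx : Integrable (fun g => g.1 k * f g) (gMu2 M M')) :
    ∫ g, g.1 k * f g ∂(gMu2 M M') = ∫ g, f' g ∂(gMu2 M M') := by
  unfold gMu2 at *
  rw [integral_prod_symm _ hx, integral_prod_symm _ hf']
  refine integral_congr_ae ?_
  filter_upwards [hx.prod_left_ae, hf'.prod_left_ae, hf.prod_left_ae] with y h1 h2 h3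
  exact integral_coord_mul_gMu k (fun g => hd (g, y)) h3 h2 h1

lemma integral_snd_coord_mul_gMu2 {M M' : ℕ} (k : Fin M')
    {f f' : (Fin M → ℝ) × (Fin M' → ℝ) → ℝ}
    (hd : ∀ g, HasDerivAt (fun a => f (g.1, Function.update g.2 k a)) (f' g) (g.2 k))
    (hf : Integrable f (gMu2 M M')) (hf' : Integrable f' (gMu2 M M'))
    (hx : Integrable (fun g => g.2 k * f g) (gMu2 M M')) :
    ∫ g, g.2 k * f g ∂(gMu2 M M') = ∫ g, f' g ∂(gMu2 M M') := by
  unfold gMu2 at *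
  rw [integral_prod _ hx, integral_prod _ hf']
  refine integral_congr_ae ?_
  filter_upwards [hx.prod_right_ae, hf'.prod_right_ae, hf.prod_right_ae] with y h1 h2 h3
  exact integral_coord_mul_gMu k (fun g => hd (y, g)) h3 h2 h1

/-- The `ℓ¹` size of a pair of vectors. -/
def gL {M M' : ℕ} (g : (Fin M → ℝ) × (Fin M' → ℝ)) : ℝ := ∑ k, |g.1 k| + ∑ k, |g.2 k|

lemma gL_nonneg {M M' : ℕ} (g : (Fin M → ℝ) × (Fin M' → ℝ)) : 0 ≤ gL g := by
  unfold gL; positivity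

lemma abs_fst_le_gL {M M' : ℕ} (g : (Fin M → ℝ) × (Fin M' → ℝ)) (k : Fin M) :
    |g.1 k| ≤ gL g := by
  have h := Finset.single_le_sum (f := fun k => |g.1 k|) (fun _ _ => abs_nonneg _)
    (Finset.mem_univ k)
  have h' : 0 ≤ ∑ k, |g.2 k| := by positivity
  unfold gL; linarith

lemma abs_snd_le_gL {M M' : ℕ} (g : (Fin M → ℝ) × (Fin M' → ℝ)) (k : Fin M') :
    |g.2 k| ≤ gL g := by
  have h := Finset.single_le_sum (f := fun k => |g.2 k|) (fun _ _ => abs_nonneg _)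
    (Finset.mem_univ k)
  have h' : 0 ≤ ∑ k, |g.1 k| := by positivity
  unfold gL; linarith

lemma integrable_exp_mul_sum_abs_gMu (M : ℕ) (c : ℝ) :
    Integrable (fun g : Fin M → ℝ => exp (c * ∑ k, |g k|)) (gMu M) := by
  have h : Integrable (fun x : ℝ => exp (c * |x|)) (gaussianReal 0 1) :=
    integrable_exp_mul_abs (X := fun x => x) (integrable_exp_mul_gaussianReal c)
      (integrable_exp_mul_gaussianReal (-c))
  have := Integrable.fintype_prod (ι := Fin M) (fun _ => h)
  simpa only [gMu, Finset.mul_sum, exp_sum] using this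

lemma integrable_exp_mul_gL (M M' : ℕ) (c : ℝ) :
    Integrable (fun g => exp (c * gL g)) (gMu2 M M') := by
  have := (integrable_exp_mul_sum_abs_gMu M c).mul_prod (integrable_exp_mul_sum_abs_gMu M' c)
  simpa only [gMu2, gL, mul_add, exp_add] using this

section LogSumExp

variable {ι : Type*} [Fintype ι]

lemma hasDerivAt_sum_exp (w : ι → ℝ) {l : ι → ℝ → ℝ} {c : ι → ℝ} {a : ℝ}
    (hl : ∀ i, HasDerivAt (l i) (c i) a) :
    HasDerivAt (fun x => ∑ i, w i * exp (l i x)) (∑ i, w i * exp (l i a) * c i) a :=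
  (HasDerivAt.fun_sum fun i _ => ((hl i).exp.const_mul (w i))).congr_deriv
    (Finset.sum_congr rfl fun i _ => by ring)

lemma hasDerivAt_sum_exp_rpow (w : ι → ℝ) {l : ι → ℝ → ℝ} {c : ι → ℝ} {a : ℝ}
    (hl : ∀ i, HasDerivAt (l i) (c i) a) (hpos : 0 < ∑ i, w i * exp (l i a)) (n : ℝ) :
    HasDerivAt (fun x => (∑ i, w i * exp (l i x)) ^ n)
      (n * ((∑ i, w i * exp (l i a)) ^ n *
        ∑ i, w i * exp (l i a) / (∑ j, w j * exp (l j a)) * c i)) a := by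
  refine ((hasDerivAt_sum_exp w hl).rpow_const (p := n) (Or.inl hpos.ne')).congr_deriv ?_
  simp only [div_mul_eq_mul_div, ← Finset.sum_div]
  rw [rpow_sub_one hpos.ne']
  ring

lemma hasDerivAt_sum_exp_rpow_mul_weight (w : ι → ℝ) {l : ι → ℝ → ℝ} {c : ι → ℝ} {a : ℝ}
    (hl : ∀ i, HasDerivAt (l i) (c i) a) (hpos : 0 < ∑ i, w i * exp (l i a)) (n : ℝ) (i : ι) :
    HasDerivAt (fun x => (∑ j, w j * exp (l j x)) ^ n *
        (w i * exp (l i x) / ∑ j, w j * exp (l j x)))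
      ((∑ j, w j * exp (l j a)) ^ n * (w i * exp (l i a) / (∑ j, w j * exp (l j a)) * c i +
        (n - 1) * (w i * exp (l i a) / (∑ j, w j * exp (l j a)) *
          ∑ j, w j * exp (l j a) / (∑ j, w j * exp (l j a)) * c j))) a := by
  refine ((hasDerivAt_sum_exp_rpow w hl hpos n).mul
    (((hl i).exp.const_mul (w i)).div (hasDerivAt_sum_exp w hl) hpos.ne')).congr_deriv ?_
  simp only [div_mul_eq_mul_div, ← Finset.sum_div, Pi.div_apply]
  field_simp
  ring

end LogSumExp

section Interpolation

variable {N M M' : ℕ}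

lemma abs_gU_le (A : Matrix (Fin N) (Fin M) ℝ) (i : Fin N) (g : Fin M → ℝ) :
    |gU A i g| ≤ (∑ i, ∑ k, |A i k|) * ∑ k, |g k| := by
  have hA (k : Fin M) : |A i k| ≤ ∑ i, ∑ k, |A i k| :=
    (Finset.single_le_sum (f := fun k => |A i k|) (fun _ _ => abs_nonneg _)
      (Finset.mem_univ k)).trans
    (Finset.single_le_sum (f := fun i => ∑ k, |A i k|) (fun _ _ => by positivity)
      (Finset.mem_univ i))
  calc |gU A i g| ≤ ∑ k, |A i k * g k| := Finset.abs_sum_le_sum_abs _ _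
    _ ≤ ∑ k, (∑ i, ∑ k, |A i k|) * |g k| := Finset.sum_le_sum fun k _ => by
        rw [abs_mul]; gcongr; exact hA k
    _ = _ := by rw [Finset.mul_sum]

lemma abs_gU_fst_le (A : Matrix (Fin N) (Fin M) ℝ) (i : Fin N)
    (g : (Fin M → ℝ) × (Fin M' → ℝ)) :
    |gU A i g.1| ≤ (∑ i, ∑ k, |A i k|) * gL g := by
  refine (abs_gU_le A i g.1).trans ?_
  have : 0 ≤ ∑ k, |g.2 k| := by positivity
  unfold gL
  gcongr
  linarith

lemma abs_gU_snd_le (A' : Matrix (Fin N) (Fin M') ℝ) (i : Fin N)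
    (g : (Fin M → ℝ) × (Fin M' → ℝ)) :
    |gU A' i g.2| ≤ (∑ i, ∑ k, |A' i k|) * gL g := by
  refine (abs_gU_le A' i g.2).trans ?_
  have : 0 ≤ ∑ k, |g.1 k| := by positivity
  unfold gL
  gcongr
  linarith

lemma hasDerivAt_gU_update (A : Matrix (Fin N) (Fin M) ℝ) (i : Fin N) (g : Fin M → ℝ)
    (k : Fin M) : HasDerivAt (fun a => gU A i (Function.update g k a)) (A i k) (g k) := by
  have h (a : ℝ) : gU A i (Function.update g k a) = gU A i g + A i k * (a - g k) := by
    have : Function.update g k a = g + Pi.single k (a - g k) := by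
      ext j
      by_cases hj : j = k
      · subst hj; simp
      · simp [hj]
    simp [this, gU, mul_add, Finset.sum_add_distrib, Pi.single_apply]
  simp only [h]
  simpa using (((hasDerivAt_id (g k)).sub_const (g k)).const_mul (A i k)).const_add (gU A i g)

variable (w : Fin N → ℝ) (A : Matrix (Fin N) (Fin M) ℝ) (A' : Matrix (Fin N) (Fin M') ℝ)

lemma gZ2_pos (hN : 1 ≤ N) (hw : ∀ i, 0 < w i) (s : ℝ) (g : (Fin M → ℝ) × (Fin M' → ℝ)) :
    0 < gZ2 w A A' s g :=
  Finset.sum_pos (fun i _ => mul_pos (hw i) (exp_pos _)) ⟨⟨0, hN⟩, Finset.mem_univ _⟩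

lemma sum_gP2 (hN : 1 ≤ N) (hw : ∀ i, 0 < w i) (s : ℝ) (g : (Fin M → ℝ) × (Fin M' → ℝ)) :
    ∑ i, gP2 w A A' s g i = 1 := by
  simp only [gP2, ← Finset.sum_div]
  exact div_self (gZ2_pos w A A' hN hw s g).ne'

lemma gP2_nonneg (hN : 1 ≤ N) (hw : ∀ i, 0 < w i) (s : ℝ) (g : (Fin M → ℝ) × (Fin M' → ℝ))
    (i : Fin N) : 0 ≤ gP2 w A A' s g i :=
  div_nonneg (mul_pos (hw i) (exp_pos _)).le (gZ2_pos w A A' hN hw s g).le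

lemma gP2_le_one (hN : 1 ≤ N) (hw : ∀ i, 0 < w i) (s : ℝ) (g : (Fin M → ℝ) × (Fin M' → ℝ))
    (i : Fin N) : gP2 w A A' s g i ≤ 1 := by
  rw [← sum_gP2 w A A' hN hw s g]
  exact Finset.single_le_sum (fun j _ => gP2_nonneg w A A' hN hw s g j) (Finset.mem_univ i)

/-- Gibbs averages are bounded by any uniform bound on the averaged vector. -/
lemma abs_sum_gP2_mul_le (hN : 1 ≤ N) (hw : ∀ i, 0 < w i) (s : ℝ)
    (g : (Fin M → ℝ) × (Fin M' → ℝ)) {c : Fin N → ℝ} {B : ℝ} (hc : ∀ i, |c i| ≤ B) :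
    |∑ i, gP2 w A A' s g i * c i| ≤ B := by
  calc |∑ i, gP2 w A A' s g i * c i| ≤ ∑ i, |gP2 w A A' s g i * c i| :=
        Finset.abs_sum_le_sum_abs _ _
    _ ≤ ∑ i, gP2 w A A' s g i * B := Finset.sum_le_sum fun i _ => by
        have := gP2_nonneg w A A' hN hw s g i
        rw [abs_mul, abs_of_nonneg this]
        gcongr
        exact hc i
    _ = B := by rw [← Finset.sum_mul, sum_gP2 w A A' hN hw, one_mul]

@[fun_prop]
lemma measurable_gU (i : Fin N) : Measurable (gU A i) := by
  unfold gU; fun_prop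

@[fun_prop]
lemma measurable_gZ2 (s : ℝ) : Measurable (gZ2 w A A' s) := by
  unfold gZ2; fun_prop

@[fun_prop]
lemma measurable_gP2 (s : ℝ) (i : Fin N) : Measurable (fun g => gP2 w A A' s g i) := by
  unfold gP2; fun_prop

lemma gZ2_rpow_le (hN : 1 ≤ N) (hw : ∀ i, 0 < w i) {n s : ℝ} (hn : n ∈ Set.Ioc (0 : ℝ) 1)
    (hs : s ∈ Set.Ioo (0 : ℝ) 1) (g : (Fin M → ℝ) × (Fin M' → ℝ)) :
    gZ2 w A A' s g ^ n ≤
      (1 + ∑ i, w i) * exp ((∑ i, ∑ k, |A i k| + ∑ i, ∑ k, |A' i k|) * gL g) := by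
  have hZ := gZ2_pos w A A' hN hw s g
  set D := (∑ i, ∑ k, |A i k| + ∑ i, ∑ k, |A' i k|) * gL g with hD
  have hD0 : 0 ≤ D := mul_nonneg (by positivity) (gL_nonneg g)
  have h1 : gZ2 w A A' s g ≤ (∑ i, w i) * exp D := by
    rw [gZ2, Finset.sum_mul]
    refine Finset.sum_le_sum fun i _ => mul_le_mul_of_nonneg_left (exp_le_exp.2 ?_) (hw i).le
    have e1 : √s ≤ 1 := sqrt_le_one.2 hs.2.le
    have e2 : √(1 - s) ≤ 1 := sqrt_le_one.2 (by linarith [hs.1])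
    have f1 : √s * gU A i g.1 ≤ |gU A i g.1| :=
      (le_abs_self _).trans (by
        rw [abs_mul, abs_of_nonneg (sqrt_nonneg s)]
        exact mul_le_of_le_one_left (abs_nonneg _) e1)
    have f2 : √(1 - s) * gU A' i g.2 ≤ |gU A' i g.2| :=
      (le_abs_self _).trans (by
        rw [abs_mul, abs_of_nonneg (sqrt_nonneg (1 - s))]
        exact mul_le_of_le_one_left (abs_nonneg _) e2)
    rw [hD, add_mul]
    linarith [abs_gU_fst_le A i g, abs_gU_snd_le A' i g]
  have h2 : gZ2 w A A' s g ^ n ≤ 1 + gZ2 w A A' s g := by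
    rcases le_total (gZ2 w A A' s g) 1 with h | h
    · linarith [rpow_le_one hZ.le h hn.1.le]
    · have := rpow_le_rpow_of_exponent_le h hn.2
      rw [rpow_one] at this
      linarith
  linarith [one_le_exp hD0]

lemma integrable_gZ2_rpow_mul (hN : 1 ≤ N) (hw : ∀ i, 0 < w i) {n s : ℝ}
    (hn : n ∈ Set.Ioc (0 : ℝ) 1) (hs : s ∈ Set.Ioo (0 : ℝ) 1)
    {q : (Fin M → ℝ) × (Fin M' → ℝ) → ℝ} (hq : Measurable q) (C : ℝ)
    (hC : ∀ g, |q g| ≤ C * (gL g + 1)) :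
    Integrable (fun g => gZ2 w A A' s g ^ n * q g) (gMu2 M M') := by
  refine ((integrable_exp_mul_gL M M'
    (∑ i, ∑ k, |A i k| + ∑ i, ∑ k, |A' i k| + 1)).const_mul ((1 + ∑ i, w i) * C)).mono'
    (Measurable.aestronglyMeasurable (by fun_prop)) (ae_of_all _ fun g => ?_)
  have hZ := rpow_nonneg (gZ2_pos w A A' hN hw s g).le n
  have hW : 0 ≤ ∑ i, w i := Finset.sum_nonneg fun i _ => (hw i).le
  have hC0 : 0 ≤ C := by
    by_contra! h
    have := hC g
    nlinarith [abs_nonneg (q g), gL_nonneg g]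
  rw [norm_mul, norm_eq_abs, norm_eq_abs, abs_of_nonneg hZ]
  calc _ ≤ ((1 + ∑ i, w i) * exp ((∑ i, ∑ k, |A i k| + ∑ i, ∑ k, |A' i k|) * gL g)) *
        (C * exp (gL g)) := by
        refine mul_le_mul (gZ2_rpow_le w A A' hN hw hn hs g) ((hC g).trans ?_) (abs_nonneg _)
          (by positivity)
        exact mul_le_mul_of_nonneg_left (add_one_le_exp _) hC0
    _ = _ := by rw [add_mul _ 1, one_mul, exp_add]; ring

lemma hasDerivAt_gZ2_rpow_mul_gP2_fst (hN : 1 ≤ N) (hw : ∀ i, 0 < w i) (n s : ℝ) (i : Fin N)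
    (g : (Fin M → ℝ) × (Fin M' → ℝ)) (k : Fin M) :
    HasDerivAt (fun a => gZ2 w A A' s (Function.update g.1 k a, g.2) ^ n *
        gP2 w A A' s (Function.update g.1 k a, g.2) i)
      (gZ2 w A A' s g ^ n * (gP2 w A A' s g i * (√s * A i k) +
        (n - 1) * (gP2 w A A' s g i * ∑ j, gP2 w A A' s g j * (√s * A j k)))) (g.1 k) := by
  have h := hasDerivAt_sum_exp_rpow_mul_weight w
    (l := fun j a => √s * gU A j (Function.update g.1 k a) + √(1 - s) * gU A' j g.2)
    (fun j => ((hasDerivAt_gU_update A j g.1 k).const_mul √s).add_const _)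
    (by simpa [gZ2] using gZ2_pos w A A' hN hw s g) n i
  simpa only [Function.update_eq_self, gP2, gZ2] using h

lemma hasDerivAt_gZ2_rpow_mul_gP2_snd (hN : 1 ≤ N) (hw : ∀ i, 0 < w i) (n s : ℝ) (i : Fin N)
    (g : (Fin M → ℝ) × (Fin M' → ℝ)) (k : Fin M') :
    HasDerivAt (fun a => gZ2 w A A' s (g.1, Function.update g.2 k a) ^ n *
        gP2 w A A' s (g.1, Function.update g.2 k a) i)
      (gZ2 w A A' s g ^ n * (gP2 w A A' s g i * (√(1 - s) * A' i k) +
        (n - 1) * (gP2 w A A' s g i * ∑ j, gP2 w A A' s g j * (√(1 - s) * A' j k))))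
      (g.2 k) := by
  have h := hasDerivAt_sum_exp_rpow_mul_weight w
    (l := fun j a => √s * gU A j g.1 + √(1 - s) * gU A' j (Function.update g.2 k a))
    (fun j => ((hasDerivAt_gU_update A' j g.2 k).const_mul √(1 - s)).const_add _)
    (by simpa [gZ2] using gZ2_pos w A A' hN hw s g) n i
  simpa only [Function.update_eq_self, gP2, gZ2] using h

section Integrability

variable (hN : 1 ≤ N) (hw : ∀ i, 0 < w i) {n s : ℝ} (hn : n ∈ Set.Ioc (0 : ℝ) 1)
  (hs : s ∈ Set.Ioo (0 : ℝ) 1)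
include hN hw hn hs

lemma integrable_gZ2_rpow_mul_gP2_mul (i : Fin N) {q : (Fin M → ℝ) × (Fin M' → ℝ) → ℝ}
    (hq : Measurable q) (C : ℝ) (hC : ∀ g, |q g| ≤ C * (gL g + 1)) :
    Integrable (fun g => gZ2 w A A' s g ^ n * (gP2 w A A' s g i * q g)) (gMu2 M M') := by
  refine integrable_gZ2_rpow_mul w A A' hN hw hn hs (by fun_prop) C fun g => ?_
  rw [abs_mul, abs_of_nonneg (gP2_nonneg w A A' hN hw s g i)]
  exact (mul_le_of_le_one_left (abs_nonneg _) (gP2_le_one w A A' hN hw s g i)).trans (hC g)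

lemma integrable_gZ2_rpow_mul_gP2_mul_sum (i : Fin N) (c : Fin N → ℝ) :
    Integrable (fun g : (Fin M → ℝ) × (Fin M' → ℝ) => gZ2 w A A' s g ^ n *
      (gP2 w A A' s g i * c i +
        (n - 1) * (gP2 w A A' s g i * ∑ j, gP2 w A A' s g j * c j))) (gMu2 M M') := by
  have hc (j : Fin N) : |c j| ≤ ∑ j, |c j| :=
    Finset.single_le_sum (f := fun j => |c j|) (fun _ _ => abs_nonneg _) (Finset.mem_univ j)
  have h := integrable_gZ2_rpow_mul_gP2_mul w A A' hN hw hn hs i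
    (q := fun g => c i + (n - 1) * ∑ j, gP2 w A A' s g j * c j) (by fun_prop)
    ((∑ j, |c j|) * 2) fun g => by
      have h1 := abs_sum_gP2_mul_le w A A' hN hw s g hc
      have h2 : |n - 1| ≤ 1 := abs_le.2 ⟨by linarith [hn.1], by linarith [hn.2]⟩
      have h3 := abs_add_le (c i) ((n - 1) * ∑ j, gP2 w A A' s g j * c j)
      rw [abs_mul] at h3
      have h4 := mul_le_of_le_one_left
        (abs_nonneg (∑ j, gP2 w A A' s g j * c j)) h2
      have h5 : 0 ≤ ∑ j, |c j| := by positivity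
      nlinarith [hc i, gL_nonneg g, mul_nonneg h5 (gL_nonneg g)]
  refine h.congr (ae_of_all _ fun g => ?_)
  simp only
  ring

omit hN hw hn hs in
lemma sum_mul_gibbs_derivative {K : ℕ} (B : Matrix (Fin N) (Fin K) ℝ) (r : ℝ) (i : Fin N)
    (g : (Fin M → ℝ) × (Fin M' → ℝ)) :
    ∑ k, B i k * (gZ2 w A A' s g ^ n * (gP2 w A A' s g i * (r * B i k) +
        (n - 1) * (gP2 w A A' s g i * ∑ j, gP2 w A A' s g j * (r * B j k)))) =
      r * (gZ2 w A A' s g ^ n * (gP2 w A A' s g i * gS B i i +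
        (n - 1) * (gP2 w A A' s g i * ∑ j, gP2 w A A' s g j * gS B i j))) := by
  have h : ∑ j, gP2 w A A' s g j * gS B i j =
      ∑ k, B i k * ∑ j, gP2 w A A' s g j * B j k := by
    simp only [gS, Finset.mul_sum]
    rw [Finset.sum_comm]
    exact Finset.sum_congr rfl fun k _ => Finset.sum_congr rfl fun j _ => by ring
  rw [h, gS]
  simp only [mul_add, Finset.mul_sum, Finset.sum_add_distrib]
  congr 1
  · exact Finset.sum_congr rfl fun k _ => by ring
  · exact Finset.sum_congr rfl fun k _ => Finset.sum_congr rfl fun j _ => by ring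

lemma integral_gZ2_rpow_mul_gP2_mul_gU_fst (i : Fin N) :
    ∫ g, gZ2 w A A' s g ^ n * (gP2 w A A' s g i * gU A i g.1) ∂(gMu2 M M') =
      √s * ∫ g, gZ2 w A A' s g ^ n * (gP2 w A A' s g i * gS A i i +
        (n - 1) * (gP2 w A A' s g i * ∑ j, gP2 w A A' s g j * gS A i j)) ∂(gMu2 M M') := by
  have hx (k : Fin M) : Integrable
      (fun g => g.1 k * (gZ2 w A A' s g ^ n * gP2 w A A' s g i)) (gMu2 M M') := by
    refine (integrable_gZ2_rpow_mul_gP2_mul w A A' hN hw hn hs i (q := fun g => g.1 k)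
      (by fun_prop) 1 fun g => ?_).congr (ae_of_all _ fun g => ?_)
    · linarith [abs_fst_le_gL g k]
    · simp only
      ring
  have hf : Integrable (fun g => gZ2 w A A' s g ^ n * gP2 w A A' s g i) (gMu2 M M') := by
    simpa using integrable_gZ2_rpow_mul_gP2_mul w A A' hN hw hn hs i (q := fun _ => 1)
      (by fun_prop) 1 fun g => by simpa using gL_nonneg g
  have hd (k : Fin M) := integrable_gZ2_rpow_mul_gP2_mul_sum w A A' hN hw hn hs i
    (fun j => √s * A j k)
  calc _ = ∫ g, ∑ k, A i k * (g.1 k * (gZ2 w A A' s g ^ n * gP2 w A A' s g i)) ∂(gMu2 M M') := by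
        congr 1 with g
        simp only [gU, Finset.mul_sum]
        exact Finset.sum_congr rfl fun k _ => by ring
    _ = ∑ k, A i k * ∫ g, g.1 k * (gZ2 w A A' s g ^ n * gP2 w A A' s g i) ∂(gMu2 M M') := by
        rw [integral_finsetSum _ fun k _ => (hx k).const_mul _]
        simp only [integral_const_mul]
    _ = _ := by
        simp only [fun k => integral_fst_coord_mul_gMu2 k
          (fun g => hasDerivAt_gZ2_rpow_mul_gP2_fst w A A' hN hw n s i g k) hf (hd k) (hx k)]
        simp only [← integral_const_mul]
        rw [← integral_finsetSum _ fun k _ => (hd k).const_mul _]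
        simp only [sum_mul_gibbs_derivative w A A']

lemma integral_gZ2_rpow_mul_gP2_mul_gU_snd (i : Fin N) :
    ∫ g, gZ2 w A A' s g ^ n * (gP2 w A A' s g i * gU A' i g.2) ∂(gMu2 M M') =
      √(1 - s) * ∫ g, gZ2 w A A' s g ^ n * (gP2 w A A' s g i * gS A' i i +
        (n - 1) * (gP2 w A A' s g i * ∑ j, gP2 w A A' s g j * gS A' i j)) ∂(gMu2 M M') := by
  have hx (k : Fin M') : Integrable
      (fun g => g.2 k * (gZ2 w A A' s g ^ n * gP2 w A A' s g i)) (gMu2 M M') := by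
    refine (integrable_gZ2_rpow_mul_gP2_mul w A A' hN hw hn hs i (q := fun g => g.2 k)
      (by fun_prop) 1 fun g => ?_).congr (ae_of_all _ fun g => ?_)
    · linarith [abs_snd_le_gL g k]
    · simp only
      ring
  have hf : Integrable (fun g => gZ2 w A A' s g ^ n * gP2 w A A' s g i) (gMu2 M M') := by
    simpa using integrable_gZ2_rpow_mul_gP2_mul w A A' hN hw hn hs i (q := fun _ => 1)
      (by fun_prop) 1 fun g => by simpa using gL_nonneg g
  have hd (k : Fin M') := integrable_gZ2_rpow_mul_gP2_mul_sum w A A' hN hw hn hs i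
    (fun j => √(1 - s) * A' j k)
  calc _ = ∫ g, ∑ k, A' i k * (g.2 k * (gZ2 w A A' s g ^ n * gP2 w A A' s g i))
        ∂(gMu2 M M') := by
        congr 1 with g
        simp only [gU, Finset.mul_sum]
        exact Finset.sum_congr rfl fun k _ => by ring
    _ = ∑ k, A' i k * ∫ g, g.2 k * (gZ2 w A A' s g ^ n * gP2 w A A' s g i) ∂(gMu2 M M') := by
        rw [integral_finsetSum _ fun k _ => (hx k).const_mul _]
        simp only [integral_const_mul]
    _ = _ := by
        simp only [fun k => integral_snd_coord_mul_gMu2 k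
          (fun g => hasDerivAt_gZ2_rpow_mul_gP2_snd w A A' hN hw n s i g k) hf (hd k) (hx k)]
        simp only [← integral_const_mul]
        rw [← integral_finsetSum _ fun k _ => (hd k).const_mul _]
        simp only [sum_mul_gibbs_derivative w A A']

/-- Differentiation under the expectation of `Z_t ^ n`. -/
lemma hasDerivAt_integral_gZ2_rpow :
    HasDerivAt (fun r => ∫ g, gZ2 w A A' r g ^ n ∂(gMu2 M M'))
      (∫ g, n * (gZ2 w A A' s g ^ n * ∑ i, gP2 w A A' s g i *
        (1 / (2 * √s) * gU A i g.1 - 1 / (2 * √(1 - s)) * gU A' i g.2)) ∂(gMu2 M M')) s := by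
  obtain ⟨h0, h1⟩ := hs
  set K := ∑ i, ∑ k, |A i k| with hK
  set K' := ∑ i, ∑ k, |A' i k| with hK'
  set R := 1 / (2 * √(s / 2)) with hR
  set R' := 1 / (2 * √((1 - s) / 2)) with hR'
  refine (hasDerivAt_integral_of_dominated_loc_of_deriv_le
    (s := Set.Ioo (s / 2) ((1 + s) / 2))
    (bound := fun g => (1 + ∑ i, w i) * (R * K + R' * K') * exp ((K + K' + 1) * gL g))
    (F := fun r g => gZ2 w A A' r g ^ n)
    (F' := fun r g => n * (gZ2 w A A' r g ^ n * ∑ i, gP2 w A A' r g i *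
        (1 / (2 * √r) * gU A i g.1 - 1 / (2 * √(1 - r)) * gU A' i g.2)))
    (Ioo_mem_nhds (by linarith) (by linarith)) (Eventually.of_forall fun r => ?_) ?_ ?_
    (ae_of_all _ fun g r hr => ?_) ((integrable_exp_mul_gL M M' _).const_mul _)
    (ae_of_all _ fun g r hr => ?_)).2
  · exact Measurable.aestronglyMeasurable (by fun_prop)
  · simpa using integrable_gZ2_rpow_mul w A A' hN hw hn ⟨h0, h1⟩ (q := fun _ => 1)
      (by fun_prop) 1 fun g => by simpa using gL_nonneg g
  · exact Measurable.aestronglyMeasurable (by fun_prop)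
  · have hr0 : 0 < r := by linarith [hr.1]
    have hr1 : r < 1 := by linarith [hr.2]
    have hZ := rpow_nonneg (gZ2_pos w A A' hN hw r g).le n
    have hb := gZ2_rpow_le w A A' hN hw hn ⟨hr0, hr1⟩ g
    have hR1 : 1 / (2 * √r) ≤ R := by
      have : 0 < √(s / 2) := sqrt_pos.2 (by linarith)
      rw [hR]; gcongr
      exact hr.1.le
    have hR2 : 1 / (2 * √(1 - r)) ≤ R' := by
      have : 0 < √((1 - s) / 2) := sqrt_pos.2 (by linarith)
      rw [hR']; gcongr
      linarith [hr.2]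
    have hsum := abs_sum_gP2_mul_le w A A' hN hw r g (B := (R * K + R' * K') * gL g)
      (c := fun i => 1 / (2 * √r) * gU A i g.1 - 1 / (2 * √(1 - r)) * gU A' i g.2) fun i => by
        refine (abs_sub _ _).trans ?_
        rw [abs_mul, abs_mul, abs_of_nonneg (by positivity : 0 ≤ 1 / (2 * √r)),
          abs_of_nonneg (by positivity : 0 ≤ 1 / (2 * √(1 - r))), add_mul, mul_assoc, mul_assoc]
        gcongr
        · exact abs_gU_fst_le A i g
        · exact abs_gU_snd_le A' i g
    have hRK : 0 ≤ R * K + R' * K' := by positivity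
    have hW : 0 ≤ ∑ i, w i := Finset.sum_nonneg fun i _ => (hw i).le
    rw [norm_eq_abs, abs_mul, abs_mul, abs_of_nonneg hZ, abs_of_pos hn.1]
    refine (mul_le_of_le_one_left (mul_nonneg hZ (abs_nonneg _)) hn.2).trans ?_
    calc _ ≤ ((1 + ∑ i, w i) * exp ((K + K') * gL g)) * ((R * K + R' * K') * exp (gL g)) := by
          refine mul_le_mul hb (hsum.trans ?_) (abs_nonneg _) (by positivity)
          exact mul_le_mul_of_nonneg_left (by linarith [add_one_le_exp (gL g)]) hRK
      _ = _ := by rw [add_mul _ 1, one_mul, exp_add]; ring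
  · have hr0 : 0 < r := by linarith [hr.1]
    have hr1 : r < 1 := by linarith [hr.2]
    refine hasDerivAt_sum_exp_rpow w
      (l := fun i r => √r * gU A i g.1 + √(1 - r) * gU A' i g.2) (fun i => ?_)
      (gZ2_pos w A A' hN hw r g) n
    have e1 := (hasDerivAt_sqrt hr0.ne').mul_const (gU A i g.1)
    have e2 := (((hasDerivAt_id r).const_sub 1).sqrt (sub_pos.2 hr1).ne').mul_const (gU A' i g.2)
    refine (e1.add e2).congr_deriv ?_
    simp only [id]
    ring

lemma integral_gZ2_rpow_pos : 0 < ∫ g, gZ2 w A A' s g ^ n ∂(gMu2 M M') := by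
  have hpos (g : (Fin M → ℝ) × (Fin M' → ℝ)) : 0 < gZ2 w A A' s g ^ n :=
    rpow_pos_of_pos (gZ2_pos w A A' hN hw s g) n
  have hint : Integrable (fun g => gZ2 w A A' s g ^ n) (gMu2 M M') := by
    simpa using integrable_gZ2_rpow_mul w A A' hN hw hn hs (q := fun _ => 1)
      (by fun_prop) 1 fun g => by simpa using gL_nonneg g
  rw [integral_pos_iff_support_of_nonneg (fun g => (hpos g).le) hint,
    Set.eq_univ_of_forall (s := Function.support _) fun g => (hpos g).ne']
  simp

lemma integrable_gZ2_rpow_mul_sum_gP2_mul (c : Fin N → ℝ) :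
    Integrable (fun g : (Fin M → ℝ) × (Fin M' → ℝ) =>
      gZ2 w A A' s g ^ n * ∑ i, gP2 w A A' s g i * c i) (gMu2 M M') := by
  simp only [Finset.mul_sum]
  refine integrable_finsetSum _ fun i _ => ?_
  refine integrable_gZ2_rpow_mul_gP2_mul w A A' hN hw hn hs i (q := fun _ => c i)
    (by fun_prop) |c i| fun g => ?_
  nlinarith [abs_nonneg (c i), mul_nonneg (abs_nonneg (c i)) (gL_nonneg g)]

lemma integrable_gZ2_rpow_mul_sum_gP2_mul_gP2_mul (c : Fin N → Fin N → ℝ) :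
    Integrable (fun g : (Fin M → ℝ) × (Fin M' → ℝ) =>
      gZ2 w A A' s g ^ n * ∑ i, ∑ j, gP2 w A A' s g i * gP2 w A A' s g j * c i j)
      (gMu2 M M') := by
  simp only [Finset.mul_sum]
  refine integrable_finsetSum _ fun i _ => integrable_finsetSum _ fun j _ => ?_
  simp only [mul_assoc]
  refine integrable_gZ2_rpow_mul_gP2_mul w A A' hN hw hn hs i
    (q := fun g => gP2 w A A' s g j * c i j) (by fun_prop) |c i j| fun g => ?_
  rw [abs_mul, abs_of_nonneg (gP2_nonneg w A A' hN hw s g j)]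
  nlinarith [abs_nonneg (c i j), mul_nonneg (abs_nonneg (c i j)) (gL_nonneg g),
    mul_le_of_le_one_left (abs_nonneg (c i j)) (gP2_le_one w A A' hN hw s g j)]

/-- The derivative of `E[Z_t ^ n]` after Gaussian integration by parts. -/
lemma integral_derivative_gZ2_rpow :
    ∫ g, n * (gZ2 w A A' s g ^ n * ∑ i, gP2 w A A' s g i *
        (1 / (2 * √s) * gU A i g.1 - 1 / (2 * √(1 - s)) * gU A' i g.2)) ∂(gMu2 M M') =
      n * (1 / 2 * ∫ g, gZ2 w A A' s g ^ n *
          ∑ i, gP2 w A A' s g i * (gS A i i - gS A' i i) ∂(gMu2 M M') +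
        (n - 1) / 2 * ∫ g, gZ2 w A A' s g ^ n *
          ∑ i, ∑ j, gP2 w A A' s g i * gP2 w A A' s g j * (gS A i j - gS A' i j)
          ∂(gMu2 M M')) := by
  have hs1 : √s ≠ 0 := (sqrt_pos.2 hs.1).ne'
  have hs2 : √(1 - s) ≠ 0 := (sqrt_pos.2 (sub_pos.2 hs.2)).ne'
  have hU (i : Fin N) := integrable_gZ2_rpow_mul_gP2_mul w A A' hN hw hn hs i
    (q := fun g => gU A i g.1) (by fun_prop) (∑ i, ∑ k, |A i k|) fun g =>
      (abs_gU_fst_le A i g).trans (by gcongr; linarith)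
  have hU' (i : Fin N) := integrable_gZ2_rpow_mul_gP2_mul w A A' hN hw hn hs i
    (q := fun g => gU A' i g.2) (by fun_prop) (∑ i, ∑ k, |A' i k|) fun g =>
      (abs_gU_snd_le A' i g).trans (by gcongr; linarith)
  have hT (i : Fin N) := integrable_gZ2_rpow_mul_gP2_mul_sum w A A' hN hw hn hs i (gS A i)
  have hT' (i : Fin N) := integrable_gZ2_rpow_mul_gP2_mul_sum w A A' hN hw hn hs i (gS A' i)
  rw [integral_const_mul]
  congr 1
  calc _ = ∫ g, ∑ i, (1 / (2 * √s) * (gZ2 w A A' s g ^ n * (gP2 w A A' s g i * gU A i g.1)) -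
          1 / (2 * √(1 - s)) * (gZ2 w A A' s g ^ n * (gP2 w A A' s g i * gU A' i g.2)))
          ∂(gMu2 M M') := by
        congr 1 with g
        rw [Finset.mul_sum]
        exact Finset.sum_congr rfl fun i _ => by ring
    _ = ∑ i, (1 / 2 * ∫ g, gZ2 w A A' s g ^ n * (gP2 w A A' s g i * gS A i i +
          (n - 1) * (gP2 w A A' s g i * ∑ j, gP2 w A A' s g j * gS A i j)) ∂(gMu2 M M') -
          1 / 2 * ∫ g, gZ2 w A A' s g ^ n * (gP2 w A A' s g i * gS A' i i +
          (n - 1) * (gP2 w A A' s g i * ∑ j, gP2 w A A' s g j * gS A' i j)) ∂(gMu2 M M')) := by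
        rw [integral_sum_const_mul_sub hU hU']
        refine Finset.sum_congr rfl fun i _ => ?_
        rw [integral_gZ2_rpow_mul_gP2_mul_gU_fst w A A' hN hw hn hs,
          integral_gZ2_rpow_mul_gP2_mul_gU_snd w A A' hN hw hn hs]
        field_simp
    _ = ∫ g, ∑ i, (1 / 2 * (gZ2 w A A' s g ^ n * (gP2 w A A' s g i * gS A i i +
          (n - 1) * (gP2 w A A' s g i * ∑ j, gP2 w A A' s g j * gS A i j))) -
          1 / 2 * (gZ2 w A A' s g ^ n * (gP2 w A A' s g i * gS A' i i +
          (n - 1) * (gP2 w A A' s g i * ∑ j, gP2 w A A' s g j * gS A' i j))))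
          ∂(gMu2 M M') := by
        rw [integral_sum_const_mul_sub hT hT']
    _ = _ := by
        rw [← integral_const_mul, ← integral_const_mul, ← integral_add
          ((integrable_gZ2_rpow_mul_sum_gP2_mul w A A' hN hw hn hs
            fun i => gS A i i - gS A' i i).const_mul _)
          ((integrable_gZ2_rpow_mul_sum_gP2_mul_gP2_mul w A A' hN hw hn hs
            fun i j => gS A i j - gS A' i j).const_mul _)]
        congr 1 with g
        simp only [Finset.mul_sum, ← Finset.sum_add_distrib]
        refine Finset.sum_congr rfl fun i _ => ?_
        simp only [mul_add, mul_sub, Finset.mul_sum, Finset.sum_sub_distrib]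
        simp only [mul_assoc, ← Finset.mul_sum]
        ring

end Integrability

end Interpolation

/-- for `n ∈ (0,1]` and `t ∈ (0,1)`, `t ↦ φ(n,t)` is differentiable with
`(d/dt) φ(n,t) = ½ ⟨ω_t(i ↦ S_{ii} - S̃_{ii})⟩_{n,t} + ((n-1)/2) ⟨Ω_t(S - S̃)⟩_{n,t}`. -/
theorem stmt3 {N M M' : ℕ} (hN : 1 ≤ N) (hM : 1 ≤ M) (hM' : 1 ≤ M')
    (w : Fin N → ℝ) (hw : ∀ i, 0 < w i)
    (A : Matrix (Fin N) (Fin M) ℝ) (A' : Matrix (Fin N) (Fin M') ℝ)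
    (n t : ℝ) (hn : n ∈ Set.Ioc (0:ℝ) 1) (ht : t ∈ Set.Ioo (0:ℝ) 1) :
    HasDerivAt (fun s => gPhi2 w A A' n s)
      ((1/2) * gAvg2 w A A' n t (fun g => ∑ i, gP2 w A A' t g i * (gS A i i - gS A' i i)) +
        ((n - 1)/2) * gAvg2 w A A' n t
          (fun g => ∑ i, ∑ j, gP2 w A A' t g i * gP2 w A A' t g j * (gS A i j - gS A' i j))) t := by
  have hpos := integral_gZ2_rpow_pos w A A' hN hw hn ht
  have hn0 : n ≠ 0 := hn.1.ne'
  refine (((hasDerivAt_integral_gZ2_rpow w A A' hN hw hn ht).log hpos.ne').const_mul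
    n⁻¹).congr_deriv ?_
  rw [integral_derivative_gZ2_rpow w A A' hN hw hn ht]
  simp only [gAvg2]
  field_simp
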